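/- Let T ≥ 1 be an integer, let U be a real random variable with E[U⁴] < ∞, and let v₁, …, v_T be independent, identically distributed real random variables with E[v_t] = 0 and E[v_t⁴] < ∞, with the random vector (v₁, …, v_T) independent of U. Define ε̄ = −(U − E[U]) + v̄, where v̄ = (1/T)·Σ_{t=1}^T v_t. Then E[ε̄⁴] = μ_{4,U} + 6·μ_{2,U}·μ_{2,v}/T + μ_{4,v}/T³ + 3·((T−1)/T³)·μ_{2,v}², where μ_{k,U} = E[(U − E[U])^k] and μ_{k,v} = E[v_t^k]. -/

import Mathlib

open MeasureTheory ProbabilityTheory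

/-- A real function whose fourth power is integrable lies in `L⁴`. -/
lemma memLp_four_of_integrable_pow {Ω : Type*} [MeasurableSpace Ω] {μ : Measure Ω}
    {X : Ω → ℝ} (hX : AEStronglyMeasurable X μ) (h : Integrable (fun ω => X ω ^ 4) μ) :
    MemLp X 4 μ := by
  refine (integrable_norm_rpow_iff hX (by norm_num) (by norm_num)).1 ?_
  refine h.congr (.of_forall fun ω => ?_)
  have h4 : (4 : ENNReal).toReal = ((4 : ℕ) : ℝ) := by norm_num
  simp only [h4, Real.rpow_natCast, Real.norm_eq_abs]
  exact (Even.pow_abs (by decide) _).symm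

/-- Powers up to the fourth of a function in `L⁴` of a finite measure are integrable. -/
lemma MeasureTheory.MemLp.integrable_pow_of_le_four {Ω : Type*} [MeasurableSpace Ω]
    {μ : Measure Ω} [IsFiniteMeasure μ] {X : Ω → ℝ} (hX : MemLp X 4 μ) {k : ℕ} (hk : k ≤ 4) :
    Integrable (fun ω => X ω ^ k) μ := by
  have h : MemLp X k μ := hX.mono_exponent (by exact_mod_cast hk)
  refine (integrable_norm_iff (hX.aestronglyMeasurable.pow k)).1 ?_
  simpa only [Pi.pow_apply, norm_pow] using h.integrable_norm_pow'

section Moments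

variable {Ω : Type*} [MeasurableSpace Ω] {μ : Measure Ω}

lemma ProbabilityTheory.IndepFun.integral_pow_mul_pow {X Y : Ω → ℝ} (h : IndepFun X Y μ)
    (hX : MemLp X 4 μ) (hY : MemLp Y 4 μ) (i j : ℕ) :
    ∫ ω, X ω ^ i * Y ω ^ j ∂μ = (∫ ω, X ω ^ i ∂μ) * ∫ ω, Y ω ^ j ∂μ :=
  (h.comp (measurable_id.pow_const i) (measurable_id.pow_const j)).integral_fun_mul_eq_mul_integral
    (hX.aestronglyMeasurable.pow i) (hY.aestronglyMeasurable.pow j)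

variable [IsProbabilityMeasure μ]

lemma ProbabilityTheory.IndepFun.integrable_pow_mul_pow {X Y : Ω → ℝ} (h : IndepFun X Y μ)
    (hX : MemLp X 4 μ) (hY : MemLp Y 4 μ) {i j : ℕ} (hi : i ≤ 4) (hj : j ≤ 4) :
    Integrable (fun ω => X ω ^ i * Y ω ^ j) μ :=
  (h.comp (measurable_id.pow_const i) (measurable_id.pow_const j)).integrable_mul
    (hX.integrable_pow_of_le_four hi) (hY.integrable_pow_of_le_four hj)

/-- The second moment of a sum of two independent centered variables. -/
lemma ProbabilityTheory.IndepFun.integral_add_pow_two {X Y : Ω → ℝ} (h : IndepFun X Y μ)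
    (hX : MemLp X 4 μ) (hY : MemLp Y 4 μ) (hX0 : ∫ ω, X ω ∂μ = 0) :
    ∫ ω, (X ω + Y ω) ^ 2 ∂μ = ∫ ω, X ω ^ 2 ∂μ + ∫ ω, Y ω ^ 2 ∂μ := by
  have e : ∀ ω, (X ω + Y ω) ^ 2 = X ω ^ 2 + 2 * (X ω ^ 1 * Y ω ^ 1) + Y ω ^ 2 :=
    fun ω => by ring
  have i20 := hX.integrable_pow_of_le_four (k := 2) (by norm_num)
  have i11 := (h.integrable_pow_mul_pow hX hY (i := 1) (j := 1) (by norm_num)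
    (by norm_num)).const_mul 2
  have i02 := hY.integrable_pow_of_le_four (k := 2) (by norm_num)
  simp_rw [e]
  rw [integral_add (i20.fun_add i11) i02, integral_add i20 i11, integral_const_mul,
    h.integral_pow_mul_pow hX hY]
  simp [hX0]

/-- The fourth moment of a sum of two independent centered variables. -/
lemma ProbabilityTheory.IndepFun.integral_add_pow_four {X Y : Ω → ℝ} (h : IndepFun X Y μ)
    (hX : MemLp X 4 μ) (hY : MemLp Y 4 μ) (hX0 : ∫ ω, X ω ∂μ = 0) (hY0 : ∫ ω, Y ω ∂μ = 0) :
    ∫ ω, (X ω + Y ω) ^ 4 ∂μ = ∫ ω, X ω ^ 4 ∂μ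
      + 6 * ((∫ ω, X ω ^ 2 ∂μ) * ∫ ω, Y ω ^ 2 ∂μ) + ∫ ω, Y ω ^ 4 ∂μ := by
  have e : ∀ ω, (X ω + Y ω) ^ 4 = X ω ^ 4 + 4 * (X ω ^ 3 * Y ω ^ 1) + 6 * (X ω ^ 2 * Y ω ^ 2)
      + 4 * (X ω ^ 1 * Y ω ^ 3) + Y ω ^ 4 := fun ω => by ring
  have i40 := hX.integrable_pow_of_le_four (k := 4) (by norm_num)
  have i31 := (h.integrable_pow_mul_pow hX hY (i := 3) (j := 1) (by norm_num)
    (by norm_num)).const_mul 4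
  have i22 := (h.integrable_pow_mul_pow hX hY (i := 2) (j := 2) (by norm_num)
    (by norm_num)).const_mul 6
  have i13 := (h.integrable_pow_mul_pow hX hY (i := 1) (j := 3) (by norm_num)
    (by norm_num)).const_mul 4
  have i04 := hY.integrable_pow_of_le_four (k := 4) (by norm_num)
  simp_rw [e]
  rw [integral_add (((i40.fun_add i31).fun_add i22).fun_add i13) i04,
    integral_add ((i40.fun_add i31).fun_add i22) i13, integral_add (i40.fun_add i31) i22,
    integral_add i40 i31]
  simp only [integral_const_mul, h.integral_pow_mul_pow hX hY]
  simp [hX0, hY0]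

/-- Second and fourth moments of a finite sum of independent centered variables with common
second moment `m₂` and fourth moment `m₄`. -/
lemma ProbabilityTheory.iIndepFun.moments_sum {ι : Type*} {v : ι → Ω → ℝ}
    (hindep : iIndepFun v μ) (hmeas : ∀ t, Measurable (v t)) (hv : ∀ t, MemLp (v t) 4 μ)
    (hmean : ∀ t, ∫ ω, v t ω ∂μ = 0) {m₂ m₄ : ℝ}
    (hm₂ : ∀ t, ∫ ω, v t ω ^ 2 ∂μ = m₂) (hm₄ : ∀ t, ∫ ω, v t ω ^ 4 ∂μ = m₄) (s : Finset ι) :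
    ∫ ω, (∑ t ∈ s, v t ω) ^ 2 ∂μ = s.card * m₂ ∧
      ∫ ω, (∑ t ∈ s, v t ω) ^ 4 ∂μ = s.card * m₄ + 3 * s.card * (s.card - 1) * m₂ ^ 2 := by
  classical
  induction s using Finset.induction_on with
  | empty => simp
  | insert a s ha ih =>
    have hS : MemLp (fun ω => ∑ t ∈ s, v t ω) 4 μ := memLp_finsetSum s fun t _ => hv t
    have hS0 : ∫ ω, ∑ t ∈ s, v t ω ∂μ = 0 := by
      rw [integral_finsetSum s fun t _ => (hv t).integrable (by norm_num)]
      simp [hmean]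
    have hI : IndepFun (v a) (fun ω => ∑ t ∈ s, v t ω) μ := by
      have := (hindep.indepFun_finsetSum_of_notMem hmeas ha).symm
      rwa [Finset.sum_fn] at this
    simp only [Finset.sum_insert ha, Finset.card_insert_of_notMem ha]
    rw [hI.integral_add_pow_two (hv a) hS (hmean a),
      hI.integral_add_pow_four (hv a) hS (hmean a) hS0, ih.1, ih.2, hm₂, hm₄]
    push_cast
    constructor <;> ring

end Moments

/-- Fourth between-moment identity: with `ε̄ = −(U − E[U]) + v̄`, where the vector
`(v₁,…,v_T)` of i.i.d. mean-zero errors is independent of `U`, one has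
`E[ε̄⁴] = μ_{4,U} + 6·μ_{2,U}·μ_{2,v}/T + μ_{4,v}/T³ + 3((T−1)/T³)·μ_{2,v}²`. -/
theorem between_fourth_moment
    {Ω : Type*} [MeasurableSpace Ω] (μ : Measure Ω) [IsProbabilityMeasure μ]
    (T : ℕ) (hT : 1 ≤ T)
    (U : Ω → ℝ) (hUmeas : Measurable U)
    (hU4 : Integrable (fun ω => (U ω) ^ 4) μ)
    (v : Fin T → Ω → ℝ)
    (hmeas : ∀ t, Measurable (v t))
    (hindep : iIndepFun v μ)
    (hident : ∀ s t : Fin T, IdentDistrib (v s) (v t) μ μ)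
    (hvU : IndepFun (fun ω => fun t : Fin T => v t ω) U μ)
    (hint1 : ∀ t, Integrable (v t) μ)
    (hmean : ∀ t, ∫ ω, v t ω ∂μ = 0)
    (hint4 : ∀ t, Integrable (fun ω => (v t ω) ^ 4) μ)
    (μ2v μ4v : ℝ)
    (hμ2v : ∀ t, ∫ ω, (v t ω) ^ 2 ∂μ = μ2v)
    (hμ4v : ∀ t, ∫ ω, (v t ω) ^ 4 ∂μ = μ4v)
    (μ2U μ4U : ℝ)
    (hμ2U : μ2U = ∫ ω, (U ω - ∫ ω', U ω' ∂μ) ^ 2 ∂μ)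
    (hμ4U : μ4U = ∫ ω, (U ω - ∫ ω', U ω' ∂μ) ^ 4 ∂μ)
    (ebar : Ω → ℝ)
    (hebar : ∀ ω, ebar ω = -(U ω - ∫ ω', U ω' ∂μ) + (1 / (T : ℝ)) * ∑ t, v t ω) :
    ∫ ω, (ebar ω) ^ 4 ∂μ
      = μ4U + 6 * μ2U * μ2v / T + μ4v / (T : ℝ) ^ 3
        + 3 * (((T : ℝ) - 1) / (T : ℝ) ^ 3) * μ2v ^ 2 := by
  have hUL : MemLp U 4 μ := memLp_four_of_integrable_pow hUmeas.aestronglyMeasurable hU4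
  have hv : ∀ t, MemLp (v t) 4 μ := fun t =>
    memLp_four_of_integrable_pow (hmeas t).aestronglyMeasurable (hint4 t)
  obtain ⟨hS2, hS4⟩ := hindep.moments_sum hmeas hv hmean hμ2v hμ4v Finset.univ
  set c := ∫ ω, U ω ∂μ with hc
  have hX : MemLp (fun ω => -(U ω - c)) 4 μ := (hUL.sub (memLp_const c)).neg
  have hX0 : ∫ ω, -(U ω - c) ∂μ = 0 := by
    rw [integral_neg, integral_sub (hUL.integrable (by norm_num)) (integrable_const c)]
    simp [hc]
  have hY : MemLp (fun ω => (1 / (T : ℝ)) * ∑ t, v t ω) 4 μ :=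
    (memLp_finsetSum Finset.univ fun t _ => hv t).const_mul _
  have hY0 : ∫ ω, (1 / (T : ℝ)) * ∑ t, v t ω ∂μ = 0 := by
    rw [integral_const_mul, integral_finsetSum _ fun t _ => hint1 t]
    simp [hmean]
  have hI : IndepFun (fun ω => -(U ω - c)) (fun ω => (1 / (T : ℝ)) * ∑ t, v t ω) μ :=
    hvU.symm.comp (φ := fun x => -(x - c)) (ψ := fun w : Fin T → ℝ => (1 / (T : ℝ)) * ∑ t, w t)
      (by fun_prop) (by fun_prop)
  have hT0 : (T : ℝ) ≠ 0 := by positivity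
  simp_rw [hebar]
  rw [hI.integral_add_pow_four hX hY hX0 hY0]
  simp only [mul_pow, integral_const_mul, hS2, hS4, Finset.card_univ, Fintype.card_fin,
    even_two.neg_pow, Even.neg_pow (by decide : Even 4), ← hμ2U, ← hμ4U]
  field_simp
  ring
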